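/- Let p ∈ [1, ∞), α ∈ (0, 1), and let (X, ‖·‖_X) be a Banach space for which there is K ∈ (0, ∞) such that for every n ∈ ℕ and every h : {−1,1}^n → X, 2^{−n} Σ_{δ∈{−1,1}^n} ‖Σ_{j=1}^n δ_j (∂_j ⊗ I_X) h‖_{L_p(X)}^p ≤ K^p ‖(Δ_{[n]}^{α} ⊗ I_X) h‖_{L_p(X)}^p. Then X has type r for every r ∈ [1, 2] with r < 1/α; that is, for each such r there exists T ∈ (0, ∞) with 2^{−n} Σ_{ε∈{−1,1}^n} ‖Σ_{j=1}^n ε_j v_j‖_X ≤ T·( Σ_{j=1}^n ‖v_j‖_X^r )^{1/r} for all n ∈ ℕ and v₁, …, v_n ∈ X. -/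

import Mathlib

open Finset

/-- The `L_p(X)` norm (normalized counting measure) of an `X`-valued function on the
discrete hypercube `{-1,1}^n` (coordinates encoded by `Bool`). -/
noncomputable def lpXnorm {n : ℕ} (p : ℝ) {X : Type*} [NormedAddCommGroup X]
    (h : (Fin n → Bool) → X) : ℝ :=
  ((∑ ε : Fin n → Bool, ‖h ε‖ ^ p) / 2 ^ n) ^ (1 / p)

/-- The Walsh function `W_A(ε) = Π_{j ∈ A} ε_j`. -/
def walsh {n : ℕ} (A : Finset (Fin n)) (ε : Fin n → Bool) : ℝ :=
  ∏ j ∈ A, (if ε j then (1 : ℝ) else -1)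

/-- The `X`-valued Fourier–Walsh coefficient `ĥ(A) = 2^{-n} Σ_ε W_A(ε) h(ε)`. -/
noncomputable def fourierX {n : ℕ} {X : Type*} [NormedAddCommGroup X] [NormedSpace ℝ X]
    (h : (Fin n → Bool) → X) (A : Finset (Fin n)) : X :=
  ((2 : ℝ) ^ n)⁻¹ • ∑ ε : Fin n → Bool, walsh A ε • h ε

/-- The vector-valued hypercube partial derivative `(∂_j ⊗ I_X) h`. -/
noncomputable def dflipX {n : ℕ} {X : Type*} [NormedAddCommGroup X] (j : Fin n)
    (h : (Fin n → Bool) → X) : (Fin n → Bool) → X :=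
  fun ε => h ε - h (Function.update ε j (!ε j))

/-- The vector-valued fractional Laplacian `(Δ_{[n]}^α ⊗ I_X) h = Σ_{A ≠ ∅} |A|^α W_A ĥ(A)`. -/
noncomputable def deltaPowX {n : ℕ} {X : Type*} [NormedAddCommGroup X] [NormedSpace ℝ X]
    (α : ℝ) (h : (Fin n → Bool) → X) : (Fin n → Bool) → X :=
  fun ε => ∑ A : Finset (Fin n),
    if A.Nonempty then (((A.card : ℝ) ^ α) * walsh A ε) • fourierX h A else 0

/-- The sign attached to a Boolean. -/
abbrev boolSign (b : Bool) : ℝ := if b then (1 : ℝ) else -1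

/-- The uniform average of a real function over the cube `{-1,1}^ι`. -/
noncomputable def cubeAvg {ι : Type*} [Fintype ι] [DecidableEq ι] (g : (ι → Bool) → ℝ) : ℝ :=
  (∑ δ : ι → Bool, g δ) / 2 ^ Fintype.card ι

section CubeAvg

variable {ι κ : Type*} [Fintype ι] [DecidableEq ι] [Fintype κ] [DecidableEq κ]

theorem cubeAvg_mono {f g : (ι → Bool) → ℝ} (h : ∀ δ, f δ ≤ g δ) : cubeAvg f ≤ cubeAvg g := by
  unfold cubeAvg
  gcongr with δ
  exact h δ

theorem cubeAvg_add (f g : (ι → Bool) → ℝ) :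
    cubeAvg (fun δ => f δ + g δ) = cubeAvg f + cubeAvg g := by
  simp only [cubeAvg, Finset.sum_add_distrib, add_div]

theorem cubeAvg_sum {β : Type*} (s : Finset β) (f : β → (ι → Bool) → ℝ) :
    cubeAvg (fun δ => ∑ b ∈ s, f b δ) = ∑ b ∈ s, cubeAvg (f b) := by
  simp only [cubeAvg, Finset.sum_div]
  exact Finset.sum_comm

theorem cubeAvg_const_mul (c : ℝ) (f : (ι → Bool) → ℝ) :
    cubeAvg (fun δ => c * f δ) = c * cubeAvg f := by
  simp only [cubeAvg, ← Finset.mul_sum, mul_div_assoc]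

theorem cubeAvg_const (c : ℝ) : cubeAvg (fun _ : ι → Bool => c) = c := by
  simp [cubeAvg]

theorem cubeAvg_comm (f : (ι → Bool) → (κ → Bool) → ℝ) :
    cubeAvg (fun δ => cubeAvg (f δ)) = cubeAvg (fun ε => cubeAvg fun δ => f δ ε) := by
  simp only [cubeAvg, ← Finset.sum_div]
  rw [Finset.sum_comm, div_right_comm]

theorem cubeAvg_rpow_le {p : ℝ} (hp : 1 ≤ p) {f : (ι → Bool) → ℝ} (hf : ∀ δ, 0 ≤ f δ) :
    cubeAvg f ^ p ≤ cubeAvg fun δ => f δ ^ p := by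
  have h := Real.rpow_arith_mean_le_arith_mean_rpow Finset.univ
    (fun _ : ι → Bool => ((2 : ℝ) ^ Fintype.card ι)⁻¹) f (fun _ _ => by positivity)
    (by simp) (fun δ _ => hf δ) hp
  simpa only [cubeAvg, ← Finset.mul_sum, div_eq_inv_mul] using h

/-- Averages of functions of finitely many coordinates do not depend on the ambient cube. -/
theorem cubeAvg_comp_injective {f : ι → κ} (hf : Function.Injective f) (g : (ι → Bool) → ℝ) :
    cubeAvg (fun δ : κ → Bool => g (δ ∘ f)) = cubeAvg g := by
  classical
  let σ : ι ⊕ ((Set.range f)ᶜ : Set κ) ≃ κ :=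
    (Equiv.sumCongr (Equiv.ofInjective f hf) (Equiv.refl _)).trans (Equiv.Set.sumCompl _)
  have hσ : ∀ i, σ (Sum.inl i) = f i := fun i => by simp [σ]
  let e : (κ → Bool) ≃ (ι → Bool) × (((Set.range f)ᶜ : Set κ) → Bool) :=
    (Equiv.arrowCongr σ.symm (Equiv.refl Bool)).trans (Equiv.sumArrowEquivProdArrow _ _ _)
  have he : ∀ δ, (e δ).1 = δ ∘ f := fun δ => by
    funext i
    simp [e, Equiv.sumArrowEquivProdArrow, hσ]
  have hcard : Fintype.card κ = Fintype.card ι + Fintype.card ((Set.range f)ᶜ : Set κ) := by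
    rw [← Fintype.card_congr σ, Fintype.card_sum]
  have hsum : ∑ δ : κ → Bool, g (δ ∘ f)
      = 2 ^ Fintype.card ((Set.range f)ᶜ : Set κ) * ∑ η, g η := by
    rw [Fintype.sum_equiv e (fun δ => g (δ ∘ f)) (fun q => g q.1) (fun δ => by rw [he])]
    rw [Fintype.sum_prod_type]
    simp [Finset.mul_sum]
  unfold cubeAvg
  rw [hsum, hcard, pow_add]
  field_simp

end CubeAvg

section Walsh

variable {n : ℕ} {X : Type*} [NormedAddCommGroup X] [NormedSpace ℝ X]

theorem abs_boolSign (b : Bool) : |boolSign b| = 1 := by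
  cases b <;> simp [boolSign]

/-- Flipping one coordinate, as a permutation of the cube. -/
def coordFlip (j : Fin n) : Equiv.Perm (Fin n → Bool) :=
  Function.Involutive.toPerm (fun ε => Function.update ε j (!ε j)) (fun ε => by simp)

theorem coordFlip_apply (j : Fin n) (ε : Fin n → Bool) :
    coordFlip j ε = Function.update ε j (!ε j) := rfl

theorem walsh_coordFlip (A : Finset (Fin n)) (j : Fin n) (ε : Fin n → Bool) :
    walsh A (coordFlip j ε) = (if j ∈ A then (-1 : ℝ) else 1) * walsh A ε := by
  unfold walsh
  have hrw : ∀ i, (if coordFlip j ε i then (1 : ℝ) else -1)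
      = (if i = j then (-1 : ℝ) else 1) * (if ε i then (1 : ℝ) else -1) := by
    intro i
    rw [coordFlip_apply]
    by_cases h : i = j
    · subst h
      cases ε i <;> simp
    · simp [h]
  simp only [hrw, Finset.prod_mul_distrib, Finset.prod_ite_eq']

theorem abs_walsh (A : Finset (Fin n)) (ε : Fin n → Bool) : |walsh A ε| = 1 := by
  unfold walsh
  rw [Finset.abs_prod]
  exact Finset.prod_eq_one fun j _ => abs_boolSign (ε j)

theorem fourierX_comp_coordFlip (h : (Fin n → Bool) → X) (A : Finset (Fin n)) (j : Fin n) :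
    fourierX (fun ε => h (coordFlip j ε)) A
      = (if j ∈ A then (-1 : ℝ) else 1) • fourierX h A := by
  unfold fourierX
  rw [smul_comm]
  congr 1
  rw [← Equiv.sum_comp (coordFlip j) (fun ε => walsh A ε • h ε), Finset.smul_sum]
  refine Finset.sum_congr rfl fun ε _ => ?_
  rw [walsh_coordFlip, smul_smul, ← mul_assoc]
  split_ifs <;> simp

theorem sum_walsh_mul_walsh (ε η : Fin n → Bool) :
    ∑ A : Finset (Fin n), walsh A ε * walsh A η = if ε = η then (2 : ℝ) ^ n else 0 := by
  have h := Finset.prod_one_add (f := fun j => boolSign (ε j) * boolSign (η j))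
    (Finset.univ : Finset (Fin n))
  simp only [walsh, ← Finset.prod_mul_distrib]
  rw [Finset.powerset_univ] at h
  rw [← h]
  split_ifs with hε
  · subst hε
    rw [Finset.prod_congr rfl (g := fun _ => (2 : ℝ))
      (fun j _ => by cases ε j <;> norm_num [boolSign])]
    simp
  · obtain ⟨j, hj⟩ := Function.ne_iff.mp hε
    refine Finset.prod_eq_zero (Finset.mem_univ j) ?_
    revert hj
    cases ε j <;> cases η j <;> simp [boolSign]

/-- Fourier–Walsh inversion. -/
theorem sum_walsh_smul_fourierX (h : (Fin n → Bool) → X) (ε : Fin n → Bool) :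
    ∑ A : Finset (Fin n), walsh A ε • fourierX h A = h ε := by
  simp only [fourierX, Finset.smul_sum, smul_smul]
  rw [Finset.sum_comm]
  have hrw : ∀ η : Fin n → Bool,
      ∑ A : Finset (Fin n), (walsh A ε * (((2 : ℝ) ^ n)⁻¹ * walsh A η)) • h η
        = if ε = η then h η else 0 := by
    intro η
    rw [← Finset.sum_smul]
    have : ∑ A : Finset (Fin n), walsh A ε * (((2 : ℝ) ^ n)⁻¹ * walsh A η)
        = ((2 : ℝ) ^ n)⁻¹ * ∑ A : Finset (Fin n), walsh A ε * walsh A η := by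
      rw [Finset.mul_sum]
      exact Finset.sum_congr rfl fun A _ => by ring
    rw [this, sum_walsh_mul_walsh]
    split_ifs <;> simp
  simp [hrw]

theorem norm_fourierX_le {h : (Fin n → Bool) → X} {M : ℝ} (hM : ∀ ε, ‖h ε‖ ≤ M)
    (A : Finset (Fin n)) : ‖fourierX h A‖ ≤ M := by
  have hs : ‖∑ ε : Fin n → Bool, walsh A ε • h ε‖ ≤ 2 ^ n * M := by
    refine (norm_sum_le _ _).trans ?_
    refine (Finset.sum_le_card_nsmul _ _ M fun ε _ => ?_).trans_eq (by simp)
    rw [norm_smul, Real.norm_eq_abs, abs_walsh, one_mul]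
    exact hM ε
  rw [fourierX, norm_smul, norm_inv, norm_pow, Real.norm_ofNat, inv_mul_le_iff₀ (by positivity)]
  exact hs

/-- If the nonconstant part of `h` is homogeneous of degree `m`, then `Δ^α` multiplies it
by `m ^ α`. -/
theorem norm_deltaPowX_le_of_homogeneous (α : ℝ) {h : (Fin n → Bool) → X} {M : ℝ}
    (hM : ∀ ε, ‖h ε‖ ≤ M) (m : ℕ)
    (hm : ∀ A : Finset (Fin n), A.Nonempty → fourierX h A ≠ 0 → A.card = m)
    (ε : Fin n → Bool) : ‖deltaPowX α h ε‖ ≤ (m : ℝ) ^ α * (2 * M) := by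
  have hE : deltaPowX α h ε = ((m : ℝ) ^ α) • (h ε - fourierX h ∅) := by
    have hrw : ∀ A : Finset (Fin n),
        (if A.Nonempty then (((A.card : ℝ) ^ α) * walsh A ε) • fourierX h A else 0)
          = ((m : ℝ) ^ α) • (walsh A ε • fourierX h A - if A = ∅ then fourierX h ∅ else 0) := by
      intro A
      rcases A.eq_empty_or_nonempty with rfl | hA
      · simp [walsh]
      · rw [if_pos hA, if_neg hA.ne_empty, sub_zero, smul_smul]
        by_cases h0 : fourierX h A = 0
        · simp [h0]
        · rw [hm A hA h0]
    unfold deltaPowX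
    rw [Finset.sum_congr rfl fun A _ => hrw A, ← Finset.smul_sum, Finset.sum_sub_distrib,
      sum_walsh_smul_fourierX]
    simp
  rw [hE, norm_smul, Real.norm_of_nonneg (by positivity)]
  gcongr
  calc ‖h ε - fourierX h ∅‖ ≤ ‖h ε‖ + ‖fourierX h ∅‖ := norm_sub_le _ _
    _ ≤ 2 * M := by linarith [hM ε, norm_fourierX_le hM ∅]

end Walsh

theorem cubeAvg_norm_rpow_eq_lpXnorm_rpow {n : ℕ} {X : Type*} [NormedAddCommGroup X]
    {p : ℝ} (hp : 1 ≤ p)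
    (h : (Fin n → Bool) → X) :
    lpXnorm p h ^ p = cubeAvg fun ε => ‖h ε‖ ^ p := by
  have h0 : 0 ≤ (∑ ε : Fin n → Bool, ‖h ε‖ ^ p) / 2 ^ n := by positivity
  rw [lpXnorm, ← Real.rpow_mul h0, one_div_mul_cancel (by linarith), Real.rpow_one, cubeAvg,
    Fintype.card_fin]

/-- The one-sided vector-valued Riesz transform inequality with constant `K`. -/
def OneSidedRiesz (p α K : ℝ) (X : Type*) [NormedAddCommGroup X] [NormedSpace ℝ X] : Prop :=
  ∀ n : ℕ, ∀ h : (Fin n → Bool) → X,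
    (∑ δ : Fin n → Bool, lpXnorm p
        (fun ε => ∑ j : Fin n, (if δ j then (1 : ℝ) else -1) • dflipX j h ε) ^ p) / 2 ^ n ≤
      K ^ p * lpXnorm p (deltaPowX α h) ^ p

section Riesz

variable {X : Type*} [NormedAddCommGroup X] [NormedSpace ℝ X] {p α K : ℝ}

/-- A pointwise lower bound for the gradient and a pointwise upper bound for the fractional
Laplacian can be compared through the Riesz inequality. -/
theorem OneSidedRiesz.le_mul (hR : OneSidedRiesz p α K X) (hp : 1 ≤ p) (hK : 0 < K) {n : ℕ}
    (h : (Fin n → Bool) → X) {L R : ℝ}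
    (hL : ∀ ε, L ≤ cubeAvg fun δ => ‖∑ j, boolSign (δ j) • dflipX j h ε‖)
    (hRb : ∀ ε, ‖deltaPowX α h ε‖ ≤ R) : L ≤ K * R := by
  have hR0 : 0 ≤ R := (norm_nonneg _).trans (hRb fun _ => true)
  rcases le_or_gt L 0 with hL0 | hL0
  · exact hL0.trans (by positivity)
  have hp0 : 0 < p := by linarith
  have hlow : L ^ p ≤ cubeAvg fun δ : Fin n → Bool =>
      cubeAvg fun ε => ‖∑ j, boolSign (δ j) • dflipX j h ε‖ ^ p := by
    rw [cubeAvg_comm]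
    calc L ^ p = cubeAvg (fun _ : Fin n → Bool => L ^ p) := (cubeAvg_const _).symm
      _ ≤ _ := cubeAvg_mono fun ε =>
        (Real.rpow_le_rpow hL0.le (hL ε) hp0.le).trans
          (cubeAvg_rpow_le hp fun _ => norm_nonneg _)
  have hup : lpXnorm p (deltaPowX α h) ^ p ≤ R ^ p := by
    rw [cubeAvg_norm_rpow_eq_lpXnorm_rpow hp, ← cubeAvg_const (ι := Fin n) (R ^ p)]
    exact cubeAvg_mono fun ε => Real.rpow_le_rpow (norm_nonneg _) (hRb ε) hp0.le
  have hmain := hR n h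
  simp only [cubeAvg_norm_rpow_eq_lpXnorm_rpow hp (X := X) (fun ε => ∑ j : Fin n, _)] at hmain
  have hfin : L ^ p ≤ (K * R) ^ p := by
    rw [Real.mul_rpow hK.le hR0]
    refine hlow.trans (le_trans (le_of_eq ?_) (hmain.trans ?_))
    · rw [cubeAvg, Fintype.card_fin]
    · gcongr
  exact (Real.rpow_le_rpow_iff hL0.le (by positivity) hp0).mp hfin

/-- The Riesz inequality for `W_{[n]} x` controls the averages of scalar sign sums. -/
theorem OneSidedRiesz.cubeAvg_norm_sum_boolSign_smul_le (hR : OneSidedRiesz p α K X)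
    (hp : 1 ≤ p) (hK : 0 < K) (n : ℕ) (x : X) :
    (cubeAvg fun δ : Fin n → Bool => ‖(∑ j, boolSign (δ j)) • x‖) ≤ K * ((n : ℝ) ^ α * ‖x‖) := by
  set h : (Fin n → Bool) → X := fun ε => walsh Finset.univ ε • x with hh
  have hflip : ∀ (j : Fin n) ε, h (coordFlip j ε) = -h ε := by
    intro j ε
    simp [hh, walsh_coordFlip]
  have hnorm : ∀ ε, ‖h ε‖ = ‖x‖ := fun ε => by
    rw [hh, norm_smul, Real.norm_eq_abs, abs_walsh, one_mul]
  have hm : ∀ A : Finset (Fin n), A.Nonempty → fourierX h A ≠ 0 → A.card = n := by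
    intro A _ h0
    suffices A = Finset.univ by simp [this]
    by_contra hne
    obtain ⟨j, hj⟩ : ∃ j, j ∉ A := by
      by_contra! hall
      exact hne (Finset.eq_univ_iff_forall.mpr hall)
    have h1 := fourierX_comp_coordFlip h A j
    simp only [hflip, if_neg hj, one_smul] at h1
    have h2 : fourierX (fun ε => -h ε) A = -fourierX h A := by
      simp [fourierX]
    rw [h2, neg_eq_iff_add_eq_zero, ← two_smul ℝ] at h1
    exact h0 ((smul_eq_zero.mp h1).resolve_left two_ne_zero)
  have key := hR.le_mul hp hK h
    (L := 2 * cubeAvg fun δ : Fin n → Bool => ‖(∑ j, boolSign (δ j)) • x‖)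
    (fun ε => ?_)
    (norm_deltaPowX_le_of_homogeneous α (fun ε => (hnorm ε).le) n hm)
  · linarith
  · rw [← cubeAvg_const_mul]
    refine cubeAvg_mono fun δ => le_of_eq ?_
    have hd : ∀ j, dflipX j h ε = (2 : ℝ) • h ε := by
      intro j
      rw [dflipX, ← coordFlip_apply, hflip, sub_neg_eq_add, two_smul]
    simp only [hd, ← Finset.sum_smul]
    rw [norm_smul, norm_smul, norm_smul, hnorm, Real.norm_ofNat]
    ring

/-- For vectors indexed by a group of exponent two, apply the Riesz inequality to the function
sending `ε` to the vector indexed by the syndrome of `ε`. -/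
theorem OneSidedRiesz.cubeAvg_norm_sum_le_of_exponent_two (hR : OneSidedRiesz p α K X)
    (hp : 1 ≤ p) (hα : 0 < α) (hK : 0 < K) {G : Type*} [AddCommGroup G] [Fintype G]
    [DecidableEq G] (hG : ∀ g : G, g + g = 0) (v : G → X) {M : ℝ} (hM : ∀ g, ‖v g‖ ≤ M) :
    (cubeAvg fun δ : G → Bool => ‖∑ g, boolSign (δ g) • v g‖)
      ≤ 3 * K * (Fintype.card G : ℝ) ^ α * M := by
  have hM0 : 0 ≤ M := (norm_nonneg _).trans (hM 0)
  obtain ⟨n, hn⟩ : ∃ n, n = Fintype.card G := ⟨_, rfl⟩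
  have e : Fin n ≃ G := (Fintype.equivFinOfCardEq hn.symm).symm
  set c : (Fin n → Bool) → G := fun ε => ∑ j, if ε j then 0 else e j with hc
  have hflip : ∀ (j : Fin n) ε, c (coordFlip j ε) = c ε + e j := by
    intro j ε
    simp only [hc]
    rw [← Finset.add_sum_erase _ _ (Finset.mem_univ j),
      ← Finset.add_sum_erase Finset.univ (fun i => if ε i then (0 : G) else e i)
        (Finset.mem_univ j)]
    have h1 : ∑ i ∈ Finset.univ.erase j, (if coordFlip j ε i then (0 : G) else e i)
        = ∑ i ∈ Finset.univ.erase j, if ε i then (0 : G) else e i :=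
      Finset.sum_congr rfl fun i hi => by
        rw [coordFlip_apply, Function.update_of_ne (Finset.ne_of_mem_erase hi)]
    rw [h1, coordFlip_apply, Function.update_self, add_right_comm]
    cases ε j <;> simp [hG]
  set h : (Fin n → Bool) → X := fun ε => v (c ε) with hh
  have hadd : ∀ (A : Finset (Fin n)), fourierX h A ≠ 0 → ∀ a b : Fin n,
      (if e.symm (e a + e b) ∈ A then (-1 : ℝ) else 1)
        = (if a ∈ A then (-1 : ℝ) else 1) * (if b ∈ A then (-1 : ℝ) else 1) := by
    intro A h0 a b
    have h1 : fourierX (fun ε => h (coordFlip (e.symm (e a + e b))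
        (coordFlip b (coordFlip a ε)))) A = fourierX h A := by
      congr 1
      funext ε
      simp only [hh, hflip, Equiv.apply_symm_apply]
      congr 1
      rw [add_assoc (c ε), add_assoc (c ε), hG, add_zero]
    rw [fourierX_comp_coordFlip
        (fun ε => h (coordFlip (e.symm (e a + e b)) (coordFlip b ε))) A a,
      fourierX_comp_coordFlip (fun ε => h (coordFlip (e.symm (e a + e b)) ε)) A b,
      fourierX_comp_coordFlip h A, smul_smul, smul_smul] at h1
    have h2 := smul_left_injective ℝ h0 (h1.trans (one_smul ℝ _).symm)
    revert h2
    split_ifs <;> norm_num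
  have hm : ∀ A : Finset (Fin n), A.Nonempty → fourierX h A ≠ 0 → A.card = n / 2 := by
    rintro A ⟨a, ha⟩ h0
    have hsum : ∑ b : Fin n, (if b ∈ A then (-1 : ℝ) else 1) = 0 := by
      have hperm := Equiv.sum_comp ((e.trans (Equiv.addLeft (e a))).trans e.symm)
        (fun b => if b ∈ A then (-1 : ℝ) else 1)
      have hmul := Finset.sum_congr (rfl : (Finset.univ : Finset (Fin n)) = Finset.univ)
        fun b _ => hadd A h0 a b
      rw [← Finset.mul_sum, if_pos ha] at hmul
      replace hperm := hmul.symm.trans hperm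
      linarith
    have hcount : ∑ b : Fin n, (if b ∈ A then (-1 : ℝ) else 1) = n - 2 * A.card := by
      have : ∀ b : Fin n, (if b ∈ A then (-1 : ℝ) else 1) = 1 - 2 * (if b ∈ A then 1 else 0) := by
        intro b
        split_ifs <;> norm_num
      simp [this, Finset.sum_sub_distrib, mul_comm]
    have h2 : n = 2 * A.card := by
      have : (n : ℝ) = 2 * A.card := by linarith
      exact_mod_cast this
    omega
  have key := hR.le_mul hp hK h
    (L := (cubeAvg fun δ : G → Bool => ‖∑ g, boolSign (δ g) • v g‖) - K * ((n : ℝ) ^ α * M))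
    (fun ε => ?_)
    (norm_deltaPowX_le_of_homogeneous α (fun ε => hM (c ε)) (n / 2) hm)
  · have hhalf : ((n / 2 : ℕ) : ℝ) ^ α ≤ (n : ℝ) ^ α := by
      refine Real.rpow_le_rpow (by positivity) ?_ hα.le
      exact_mod_cast Nat.div_le_self n 2
    have hb : K * (((n / 2 : ℕ) : ℝ) ^ α * (2 * M)) ≤ K * ((n : ℝ) ^ α * (2 * M)) := by gcongr
    rw [← hn]
    linarith
  · let σ : Fin n ≃ G := e.trans (Equiv.addLeft (c ε))
    have hrad : (cubeAvg fun δ : G → Bool => ‖∑ g, boolSign (δ g) • v g‖)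
        = cubeAvg fun δ : Fin n → Bool => ‖∑ j, boolSign (δ j) • v (c ε + e j)‖ := by
      rw [← cubeAvg_comp_injective σ.injective]
      congr 1
      funext δ
      rw [← Equiv.sum_comp σ]
      rfl
    have hscal := hR.cubeAvg_norm_sum_boolSign_smul_le hp hK n (v (c ε))
    have hscal' : K * ((n : ℝ) ^ α * ‖v (c ε)‖) ≤ K * ((n : ℝ) ^ α * M) := by
      gcongr
      exact hM _
    have htri : (cubeAvg fun δ : Fin n → Bool => ‖∑ j, boolSign (δ j) • v (c ε + e j)‖)
        ≤ (cubeAvg fun δ : Fin n → Bool => ‖(∑ j, boolSign (δ j)) • v (c ε)‖)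
          + cubeAvg fun δ => ‖∑ j, boolSign (δ j) • dflipX j h ε‖ := by
      rw [← cubeAvg_add]
      refine cubeAvg_mono fun δ => ?_
      have : ∑ j, boolSign (δ j) • v (c ε + e j)
          = (∑ j, boolSign (δ j)) • v (c ε) - ∑ j, boolSign (δ j) • dflipX j h ε := by
        rw [Finset.sum_smul, ← Finset.sum_sub_distrib]
        refine Finset.sum_congr rfl fun j _ => ?_
        rw [dflipX, ← coordFlip_apply, ← smul_sub, sub_sub_cancel]
        simp only [hh, hflip]
      rw [this]
      exact norm_sub_le _ _
    linarith

/-- Random sign sums of at most `2 ^ k` vectors grow at most like `2 ^ (k α)`. -/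
theorem OneSidedRiesz.cubeAvg_norm_sum_finset_le (hR : OneSidedRiesz p α K X)
    (hp : 1 ≤ p) (hα : 0 < α) (hK : 0 < K) {ι : Type*} [Fintype ι] [DecidableEq ι] (v : ι → X)
    (S : Finset ι) {M : ℝ} (hM0 : 0 ≤ M) (hM : ∀ j ∈ S, ‖v j‖ ≤ M) {k : ℕ}
    (hk : S.card ≤ 2 ^ k) :
    (cubeAvg fun δ : ι → Bool => ‖∑ j ∈ S, boolSign (δ j) • v j‖)
      ≤ 3 * K * ((2 : ℝ) ^ k) ^ α * M := by
  have hcard : Fintype.card (Fin k → ZMod 2) = 2 ^ k := by simp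
  obtain ⟨f⟩ : Nonempty (S ↪ (Fin k → ZMod 2)) :=
    Function.Embedding.nonempty_of_card_le (by rwa [hcard, Fintype.card_coe])
  set w : (Fin k → ZMod 2) → X := Function.extend f (fun j : S => v j) 0 with hw
  have hwM : ∀ g, ‖w g‖ ≤ M := by
    intro g
    by_cases hg : ∃ j, f j = g
    · obtain ⟨j, rfl⟩ := hg
      rw [hw, f.injective.extend_apply]
      exact hM j j.2
    · rw [hw, Function.extend_apply' _ _ _ hg]
      simpa using hM0
  have key := hR.cubeAvg_norm_sum_le_of_exponent_two hp hα hK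
    (fun g : Fin k → ZMod 2 => funext fun i => CharTwo.add_self_eq_zero (g i)) w hwM
  rw [hcard] at key
  push_cast at key
  refine le_trans (le_of_eq ?_) key
  have h1 : (cubeAvg fun δ : ι → Bool => ‖∑ j ∈ S, boolSign (δ j) • v j‖)
      = cubeAvg fun δ : S → Bool => ‖∑ j : S, boolSign (δ j) • v j‖ := by
    rw [← cubeAvg_comp_injective (Subtype.val_injective (p := (· ∈ S)))]
    congr 1
    funext δ
    rw [← Finset.sum_coe_sort S]
    rfl
  rw [h1, ← cubeAvg_comp_injective f.injective]
  congr 1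
  funext δ
  congr 1
  rw [← Finset.sum_subset (Finset.subset_univ (Finset.univ.map f)) ?_, Finset.sum_map]
  · simp [hw, f.injective.extend_apply]
  · intro g _ hg
    have hg' : ¬ ∃ j, f j = g := by simpa using hg
    rw [hw, Function.extend_apply' _ _ _ hg']
    simp

end Riesz

/-- Dyadic decomposition: growth of order `2 ^ (k α)` for sums of `2 ^ k` bounded vectors gives
type `r` whenever `α < 1 / r`. -/
theorem cubeAvg_norm_sum_le_of_growth {X : Type*} [NormedAddCommGroup X] [NormedSpace ℝ X]
    {ι : Type*} [Fintype ι] [DecidableEq ι] {α r C : ℝ} (hr : 0 < r) (hαr : α < 1 / r)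
    (hC : 0 ≤ C) (v : ι → X)
    (hgrowth : ∀ (S : Finset ι) (M : ℝ) (k : ℕ), 0 ≤ M → (∀ j ∈ S, ‖v j‖ ≤ M) →
      S.card ≤ 2 ^ k →
      (cubeAvg fun δ : ι → Bool => ‖∑ j ∈ S, boolSign (δ j) • v j‖)
        ≤ C * ((2 : ℝ) ^ k) ^ α * M) :
    (cubeAvg fun δ : ι → Bool => ‖∑ j, boolSign (δ j) • v j‖)
      ≤ C * 2 ^ α * (1 - (2 : ℝ) ^ (α - 1 / r))⁻¹ * (∑ j, ‖v j‖ ^ r) ^ (1 / r) := by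
  classical
  set s : ℝ := ∑ j, ‖v j‖ ^ r with hs
  set q : ℝ := (2 : ℝ) ^ (α - 1 / r) with hq
  have hs0 : 0 ≤ s := by positivity
  have hq0 : 0 ≤ q := by positivity
  have hq1 : q < 1 := Real.rpow_lt_one_of_one_lt_of_neg one_lt_two (by linarith)
  have hlevel : ∀ j, ∃ k : ℕ, v j ≠ 0 → s * (1 / 2) ^ (k + 1) < ‖v j‖ ^ r ∧
      ‖v j‖ ^ r ≤ s * (1 / 2) ^ k := by
    intro j
    by_cases hj : v j = 0
    · exact ⟨0, fun h => absurd hj h⟩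
    have hpos : 0 < ‖v j‖ ^ r := Real.rpow_pos_of_pos (norm_pos_iff.mpr hj) r
    have hle : ‖v j‖ ^ r ≤ s :=
      Finset.single_le_sum (f := fun j => ‖v j‖ ^ r) (fun i _ => by positivity)
        (Finset.mem_univ j)
    have hspos : 0 < s := hpos.trans_le hle
    obtain ⟨k, hk1, hk2⟩ := exists_nat_pow_near_of_lt_one (div_pos hpos hspos)
      ((div_le_one hspos).mpr hle) (by norm_num : (0 : ℝ) < 1 / 2) (by norm_num)
    refine ⟨k, fun _ => ⟨?_, ?_⟩⟩
    · rwa [lt_div_iff₀ hspos, mul_comm] at hk1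
    · rwa [div_le_iff₀ hspos, mul_comm] at hk2
  choose κ hκ using hlevel
  set U : Finset ι := Finset.univ.filter fun j => v j ≠ 0 with hU
  set J : ℕ → Finset ι := fun k => U.filter fun j => κ j = k with hJ
  have hmem : ∀ {k j}, j ∈ J k → v j ≠ 0 ∧ κ j = k := by
    intro k j hj
    simpa [hJ, hU] using hj
  have hcard : ∀ k, (J k).card ≤ 2 ^ (k + 1) := by
    intro k
    rcases (J k).eq_empty_or_nonempty with h0 | ⟨j₀, hj₀⟩
    · simp [h0]
    have hspos : 0 < s := by
      have h1 := (hκ j₀ (hmem hj₀).1).2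
      have h2 : 0 < ‖v j₀‖ ^ r := Real.rpow_pos_of_pos (norm_pos_iff.mpr (hmem hj₀).1) r
      exact pos_of_mul_pos_left (h2.trans_le h1) (by positivity)
    have h1 : ((J k).card : ℝ) * (s * (1 / 2) ^ (k + 1)) ≤ s := by
      rw [← nsmul_eq_mul]
      refine (Finset.card_nsmul_le_sum (J k) (fun j => ‖v j‖ ^ r) _ fun j hj => ?_).trans
        (Finset.sum_le_sum_of_subset_of_nonneg (Finset.subset_univ _)
          fun j _ _ => by positivity)
      obtain ⟨hj1, rfl⟩ := hmem hj
      exact (hκ j hj1).1.le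
    have h2 : ((J k).card : ℝ) ≤ 2 ^ (k + 1) := by
      rw [one_div, inv_pow] at h1
      have h3 : ((J k).card : ℝ) * (2 ^ (k + 1))⁻¹ * s ≤ 1 * s := by linarith
      have h4 := le_of_mul_le_mul_right h3 hspos
      rwa [← div_eq_mul_inv, div_le_one (by positivity)] at h4
    exact_mod_cast h2
  have hblock : ∀ k, (cubeAvg fun δ : ι → Bool => ‖∑ j ∈ J k, boolSign (δ j) • v j‖)
      ≤ C * 2 ^ α * s ^ (1 / r) * q ^ k := by
    intro k
    refine (hgrowth (J k) ((s * (1 / 2) ^ k) ^ (1 / r)) (k + 1) (by positivity)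
      (fun j hj => ?_) (hcard k)).trans_eq ?_
    · obtain ⟨hj1, rfl⟩ := hmem hj
      have := Real.rpow_le_rpow (by positivity) (hκ j hj1).2 (by positivity : 0 ≤ 1 / r)
      rwa [← Real.rpow_mul (norm_nonneg _), mul_one_div_cancel hr.ne', Real.rpow_one] at this
    · have hqk : q ^ k = ((2 : ℝ) ^ k) ^ α * ((1 / 2 : ℝ) ^ k) ^ (1 / r) := by
        rw [hq, Real.rpow_sub two_pos, div_pow, one_div (2 : ℝ), inv_pow,
          Real.inv_rpow (by positivity), ← Real.rpow_natCast, ← Real.rpow_natCast,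
          ← Real.rpow_natCast, ← Real.rpow_mul two_pos.le, ← Real.rpow_mul two_pos.le,
          ← Real.rpow_mul two_pos.le, ← Real.rpow_mul two_pos.le, mul_comm α,
          mul_comm (1 / r), div_eq_mul_inv]
      rw [hqk, Real.mul_rpow hs0 (by positivity), pow_succ,
        Real.mul_rpow (by positivity) two_pos.le]
      ring
  have hdecomp : ∀ δ : ι → Bool, ∑ j, boolSign (δ j) • v j
      = ∑ k ∈ U.image κ, ∑ j ∈ J k, boolSign (δ j) • v j := by
    intro δ
    rw [Finset.sum_fiberwise_of_maps_to fun j hj => Finset.mem_image_of_mem κ hj]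
    refine (Finset.sum_subset (Finset.subset_univ U) fun j _ hj => ?_).symm
    have : v j = 0 := by simpa [hU] using hj
    simp [this]
  calc (cubeAvg fun δ : ι → Bool => ‖∑ j, boolSign (δ j) • v j‖)
      ≤ cubeAvg fun δ : ι → Bool => ∑ k ∈ U.image κ, ‖∑ j ∈ J k, boolSign (δ j) • v j‖ :=
        cubeAvg_mono fun δ => by
          rw [hdecomp]
          exact norm_sum_le _ _
    _ = ∑ k ∈ U.image κ, cubeAvg fun δ : ι → Bool => ‖∑ j ∈ J k, boolSign (δ j) • v j‖ :=
        cubeAvg_sum _ _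
    _ ≤ ∑ k ∈ U.image κ, C * 2 ^ α * s ^ (1 / r) * q ^ k :=
        Finset.sum_le_sum fun k _ => hblock k
    _ = C * 2 ^ α * s ^ (1 / r) * ∑ k ∈ U.image κ, q ^ k := by rw [Finset.mul_sum]
    _ ≤ C * 2 ^ α * s ^ (1 / r) * (1 - q)⁻¹ := by
        gcongr
        rw [← tsum_geometric_of_lt_one hq0 hq1]
        exact (summable_geometric_of_lt_one hq0 hq1).sum_le_tsum _ fun _ _ => by positivity
    _ = _ := by ring

/-- **Proposition 4.2**: let `p ∈ [1,∞)`, `α ∈ (0,1)`, and let `X` be a Banach space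
satisfying the one-sided vector-valued Riesz transform inequality
`2^{-n} Σ_δ ‖Σ_j δ_j (∂_j ⊗ I_X) h‖_{L_p(X)}^p ≤ K^p ‖(Δ_{[n]}^α ⊗ I_X) h‖_{L_p(X)}^p`.
Then `X` has type `r` for every `r ∈ [1,2]` with `r < 1/α`. -/
theorem one_sided_riesz_implies_type (p : ℝ) (hp : 1 ≤ p) (α : ℝ) (hα0 : 0 < α)
    (hα1 : α < 1)
    {X : Type*} [NormedAddCommGroup X] [NormedSpace ℝ X] [CompleteSpace X]
    (K : ℝ) (hK : 0 < K)
    (hRiesz : ∀ n : ℕ, ∀ h : (Fin n → Bool) → X,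
      (∑ δ : Fin n → Bool, lpXnorm p
          (fun ε => ∑ j : Fin n, (if δ j then (1 : ℝ) else -1) • dflipX j h ε) ^ p) /
        2 ^ n ≤
      K ^ p * lpXnorm p (deltaPowX α h) ^ p) :
    ∀ r : ℝ, 1 ≤ r → r ≤ 2 → r < 1 / α →
      ∃ T : ℝ, 0 < T ∧ ∀ n : ℕ, ∀ v : Fin n → X,
        (∑ ε : Fin n → Bool, ‖∑ j : Fin n, (if ε j then (1 : ℝ) else -1) • v j‖) / 2 ^ n ≤
          T * (∑ j : Fin n, ‖v j‖ ^ r) ^ (1 / r) := by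
  intro r hr1 _ hrα
  have hr : 0 < r := by linarith
  have hαr : α < 1 / r := (lt_one_div hr hα0).mp hrα
  have hq1 : (2 : ℝ) ^ (α - 1 / r) < 1 :=
    Real.rpow_lt_one_of_one_lt_of_neg one_lt_two (by linarith)
  have hR : OneSidedRiesz p α K X := hRiesz
  refine ⟨3 * K * 2 ^ α * (1 - (2 : ℝ) ^ (α - 1 / r))⁻¹, ?_, fun n v => ?_⟩
  · have : 0 < (1 - (2 : ℝ) ^ (α - 1 / r))⁻¹ := inv_pos.mpr (by linarith)
    positivity
  · have h := cubeAvg_norm_sum_le_of_growth hr hαr (by positivity : 0 ≤ 3 * K) v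
      fun S M k hM0 hM hk => hR.cubeAvg_norm_sum_finset_le hp hα0 hK v S hM0 hM hk
    rwa [cubeAvg, Fintype.card_fin] at h
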